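/- arXiv:math/0607427 — 2 statements merged into one kernel-verified Lean document; each statement's English description precedes it below -/
import Mathlib

section
/- The Malvenuto–Reutenauer product on A = ⊕_n k[S_n], defined by σ ∗ τ = Σ_{ξ ∈ Sh_{p,q}} (σ × τ)·ξ for σ ∈ S_p, τ ∈ S_q (sum over all (p,q)-shuffles ξ, with · denoting right multiplication in S_{p+q}), is associative with unit the empty permutation in S_0. -/
/-- The block permutation `σ × τ ∈ S_{p+q}`. -/
def blockProd {p q : ℕ} (σ : Equiv.Perm (Fin p)) (τ : Equiv.Perm (Fin q)) :
    Equiv.Perm (Fin (p + q)) :=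
  finSumFinEquiv.symm.trans ((Equiv.sumCongr σ τ).trans finSumFinEquiv)

/-- A `(p,q)`-shuffle: `α⁻¹` is increasing on the first `p` and the last `q` positions. -/
def IsShuffle (p q : ℕ) (α : Equiv.Perm (Fin (p + q))) : Prop :=
  (∀ i j : Fin (p + q), (i : ℕ) < p → (j : ℕ) < p → i < j → α⁻¹ i < α⁻¹ j) ∧
    (∀ i j : Fin (p + q), p ≤ (i : ℕ) → p ≤ (j : ℕ) → i < j → α⁻¹ i < α⁻¹ j)

instance (p q : ℕ) : DecidablePred (IsShuffle p q) := fun α => by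
  unfold IsShuffle; infer_instance

/-- `A = ⊕_n k[S_n]`, the direct sum of the group algebras of the symmetric groups. -/
abbrev PermAlg (k : Type*) [CommRing k] : Type _ := (Σ n : ℕ, Equiv.Perm (Fin n)) →₀ k

/-- The Malvenuto–Reutenauer product: `σ ∗ τ = Σ_{ξ ∈ Sh_{p,q}} (σ × τ) · ξ`,
extended bilinearly. -/
noncomputable def mrMul (k : Type*) [CommRing k] (f g : PermAlg k) : PermAlg k :=
  f.sum fun s a => g.sum fun t b =>
    ∑ ξ ∈ Finset.univ.filter (IsShuffle s.1 t.1),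
      Finsupp.single ⟨s.1 + t.1, blockProd s.2 t.2 * ξ⟩ (a * b)

/-- The summands `π` of `σ ∗ τ`: reading the values of each block of `π⁻¹` in the order prescribed
by `σ`, respectively `τ`, gives an increasing sequence. -/
def IsSummand {p q : ℕ} (σ : Equiv.Perm (Fin p)) (τ : Equiv.Perm (Fin q))
    (π : Equiv.Perm (Fin (p + q))) : Prop :=
  StrictMono (fun i => π⁻¹ (Fin.castAdd q (σ i))) ∧ StrictMono (fun i => π⁻¹ (Fin.natAdd p (τ i)))

theorem blockProd_castAdd {p q : ℕ} (σ : Equiv.Perm (Fin p)) (τ : Equiv.Perm (Fin q)) (i : Fin p) :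
    blockProd σ τ (Fin.castAdd q i) = Fin.castAdd q (σ i) := by
  simp [blockProd]

theorem blockProd_natAdd {p q : ℕ} (σ : Equiv.Perm (Fin p)) (τ : Equiv.Perm (Fin q)) (i : Fin q) :
    blockProd σ τ (Fin.natAdd p i) = Fin.natAdd p (τ i) := by
  simp [blockProd]

theorem isShuffle_iff_strictMono {p q : ℕ} (ξ : Equiv.Perm (Fin (p + q))) :
    IsShuffle p q ξ ↔
      StrictMono (fun i => ξ⁻¹ (Fin.castAdd q i)) ∧ StrictMono (fun i => ξ⁻¹ (Fin.natAdd p i)) := by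
  refine and_congr ⟨fun h i j hij => h _ _ i.2 j.2 hij, fun h i j hi hj hij => ?_⟩
    ⟨fun h i j hij => h _ _ (by simp) (by simp) (by simpa using hij), fun h i j hi hj hij => ?_⟩
  · exact @h ⟨i, hi⟩ ⟨j, hj⟩ hij
  · obtain ⟨i, rfl⟩ : ∃ i', Fin.natAdd p i' = i :=
      ⟨⟨i - p, by omega⟩, Fin.ext (Nat.add_sub_cancel' hi)⟩
    obtain ⟨j, rfl⟩ : ∃ j', Fin.natAdd p j' = j :=
      ⟨⟨j - p, by omega⟩, Fin.ext (Nat.add_sub_cancel' hj)⟩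
    exact h (by simpa using hij)

theorem isShuffle_iff_isSummand {p q : ℕ} (σ : Equiv.Perm (Fin p)) (τ : Equiv.Perm (Fin q))
    (ξ : Equiv.Perm (Fin (p + q))) :
    IsShuffle p q ξ ↔ IsSummand σ τ (blockProd σ τ * ξ) := by
  simp only [isShuffle_iff_strictMono, IsSummand, ← blockProd_castAdd σ τ, ← blockProd_natAdd σ τ,
    mul_inv_rev, Equiv.Perm.mul_apply, Equiv.Perm.inv_def,
    Equiv.symm_apply_apply]

theorem perm_eq_of_strictMono_comp {n : ℕ} {β : Type*} [LinearOrder β] [WellFoundedLT β]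
    {f : Fin n → β} {π π' : Equiv.Perm (Fin n)} (h : StrictMono (f ∘ π))
    (h' : StrictMono (f ∘ π')) : π = π' := by
  have hf : Function.Injective f := by
    simpa using h.injective
  have he : f ∘ π = f ∘ π' := by
    rw [← h.range_inj h']
    simp
  exact Equiv.ext fun i => hf (congrFun he i)

theorem exists_strictMono_comp_perm {n : ℕ} {β : Type*} [LinearOrder β]
    {f : Fin n → β} (hf : Function.Injective f) :
    ∃ π : Equiv.Perm (Fin n), StrictMono (f ∘ π) :=
  ⟨Tuple.sort f, (Tuple.monotone_sort f).strictMono_of_injective (hf.comp (Equiv.injective _))⟩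

theorem strictMono_inv_comp_iff {m n : ℕ} {β : Type*} [LinearOrder β] {f : Fin n → β}
    {π : Equiv.Perm (Fin n)} (h : StrictMono (f ∘ π)) (g : Fin m → Fin n) :
    StrictMono (fun i => π⁻¹ (g i)) ↔ StrictMono (fun i => f (g i)) := by
  have key : ∀ i, f (g i) = (f ∘ π) (π⁻¹ (g i)) := fun i => by simp
  simp only [StrictMono, key, h.lt_iff_lt]

theorem sum_single_perm_congr {k : Type*} [CommRing k] {m n : ℕ} (h : m = n) (c : k)
    {P : Equiv.Perm (Fin m) → Prop} {Q : Equiv.Perm (Fin n) → Prop}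
    [DecidablePred P] [DecidablePred Q] (hPQ : ∀ θ, P θ ↔ Q ((finCongr h).permCongr θ)) :
    ∑ θ with P θ, (Finsupp.single ⟨m, θ⟩ c : PermAlg k) = ∑ θ with Q θ, Finsupp.single ⟨n, θ⟩ c := by
  subst h
  have : P = Q := funext fun θ => propext (hPQ θ)
  subst this
  congr!

theorem mrMul_add_left {k : Type*} [CommRing k] (f f' g : PermAlg k) :
    mrMul k (f + f') g = mrMul k f g + mrMul k f' g := by
  refine Finsupp.sum_add_index' (fun s => by simp) fun s a a' => ?_
  simp only [← Finsupp.sum_add, ← Finset.sum_add_distrib, ← Finsupp.single_add, add_mul]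

theorem mrMul_add_right {k : Type*} [CommRing k] (f g g' : PermAlg k) :
    mrMul k f (g + g') = mrMul k f g + mrMul k f g' := by
  simp only [mrMul, ← Finsupp.sum_add]
  refine Finsupp.sum_congr fun s _ => Finsupp.sum_add_index' (fun t => by simp) fun t b b' => ?_
  simp only [← Finset.sum_add_distrib, ← Finsupp.single_add, mul_add]

theorem mrMul_zero_left {k : Type*} [CommRing k] (g : PermAlg k) : mrMul k 0 g = 0 := by
  simp [mrMul]

theorem mrMul_zero_right {k : Type*} [CommRing k] (f : PermAlg k) : mrMul k f 0 = 0 := by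
  simp [mrMul]

theorem mrMul_sum_left {k : Type*} [CommRing k] {ι : Type*} (s : Finset ι) (f : ι → PermAlg k)
    (g : PermAlg k) : mrMul k (∑ i ∈ s, f i) g = ∑ i ∈ s, mrMul k (f i) g :=
  map_sum (AddMonoidHom.mk' (mrMul k · g) (mrMul_add_left · · g)) f s

theorem mrMul_sum_right {k : Type*} [CommRing k] {ι : Type*} (s : Finset ι) (f : PermAlg k)
    (g : ι → PermAlg k) : mrMul k f (∑ i ∈ s, g i) = ∑ i ∈ s, mrMul k f (g i) :=
  map_sum (AddMonoidHom.mk' (mrMul k f) (mrMul_add_right f)) g s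

open Classical in
theorem mrMul_single {k : Type*} [CommRing k] {p q : ℕ} (σ : Equiv.Perm (Fin p))
    (τ : Equiv.Perm (Fin q)) (a b : k) :
    mrMul k (Finsupp.single ⟨p, σ⟩ a) (Finsupp.single ⟨q, τ⟩ b) =
      ∑ π with IsSummand σ τ π, Finsupp.single ⟨p + q, π⟩ (a * b) := by
  rw [mrMul, Finsupp.sum_single_index (by simp), Finsupp.sum_single_index (by simp)]
  exact Finset.sum_equiv (Equiv.mulLeft (blockProd σ τ))
    (by simp [isShuffle_iff_isSummand σ τ]) (by simp)

open Classical in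
theorem mrMul_mrMul_single_left {k : Type*} [CommRing k] {p q r : ℕ} (σ : Equiv.Perm (Fin p))
    (τ : Equiv.Perm (Fin q)) (ρ : Equiv.Perm (Fin r)) (a b c : k) :
    mrMul k (mrMul k (Finsupp.single ⟨p, σ⟩ a) (Finsupp.single ⟨q, τ⟩ b))
        (Finsupp.single ⟨r, ρ⟩ c) =
      ∑ θ : Equiv.Perm (Fin (p + q + r)) with
        StrictMono (fun i => θ⁻¹ (Fin.castAdd r (Fin.castAdd q (σ i)))) ∧
        StrictMono (fun i => θ⁻¹ (Fin.castAdd r (Fin.natAdd p (τ i)))) ∧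
        StrictMono (fun i => θ⁻¹ (Fin.natAdd (p + q) (ρ i))),
        Finsupp.single ⟨p + q + r, θ⟩ (a * b * c) := by
  simp only [mrMul_single, mrMul_sum_left]
  rw [Finset.sum_sigma']
  refine Finset.sum_nbij (fun x => x.2) ?_ ?_ ?_ (fun _ _ => rfl)
  · rintro ⟨π, θ⟩ h
    simp only [Finset.mem_sigma, Finset.mem_filter_univ] at h ⊢
    obtain ⟨⟨h₁, h₂⟩, h₃, h₄⟩ := h
    exact ⟨(strictMono_inv_comp_iff (f := fun i => θ⁻¹ (Fin.castAdd r i)) h₃ _).1 h₁,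
      (strictMono_inv_comp_iff (f := fun i => θ⁻¹ (Fin.castAdd r i)) h₃ _).1 h₂, h₄⟩
  · rintro ⟨π, θ⟩ h ⟨π', θ'⟩ h' (rfl : θ = θ')
    simp only [Finset.mem_coe, Finset.mem_sigma, Finset.mem_filter_univ] at h h'
    obtain rfl : π = π' :=
      perm_eq_of_strictMono_comp (f := fun i => θ⁻¹ (Fin.castAdd r i)) h.2.1 h'.2.1
    rfl
  · rintro θ h
    simp only [Finset.mem_coe, Finset.mem_filter_univ] at h
    obtain ⟨π, hπ⟩ := exists_strictMono_comp_perm (f := fun i => θ⁻¹ (Fin.castAdd r i))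
      (θ⁻¹.injective.comp (Fin.castAdd_injective _ _))
    refine ⟨⟨π, θ⟩, ?_, rfl⟩
    simp only [Finset.mem_coe, Finset.mem_sigma, Finset.mem_filter_univ]
    exact ⟨⟨(strictMono_inv_comp_iff hπ _).2 h.1, (strictMono_inv_comp_iff hπ _).2 h.2.1⟩, hπ,
      h.2.2⟩

open Classical in
theorem mrMul_mrMul_single_right {k : Type*} [CommRing k] {p q r : ℕ} (σ : Equiv.Perm (Fin p))
    (τ : Equiv.Perm (Fin q)) (ρ : Equiv.Perm (Fin r)) (a b c : k) :
    mrMul k (Finsupp.single ⟨p, σ⟩ a)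
        (mrMul k (Finsupp.single ⟨q, τ⟩ b) (Finsupp.single ⟨r, ρ⟩ c)) =
      ∑ θ : Equiv.Perm (Fin (p + (q + r))) with
        StrictMono (fun i => θ⁻¹ (Fin.castAdd (q + r) (σ i))) ∧
        StrictMono (fun i => θ⁻¹ (Fin.natAdd p (Fin.castAdd r (τ i)))) ∧
        StrictMono (fun i => θ⁻¹ (Fin.natAdd p (Fin.natAdd q (ρ i)))),
        Finsupp.single ⟨p + (q + r), θ⟩ (a * (b * c)) := by
  simp only [mrMul_single, mrMul_sum_right]
  rw [Finset.sum_sigma']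
  refine Finset.sum_nbij (fun x => x.2) ?_ ?_ ?_ (fun _ _ => rfl)
  · rintro ⟨π, θ⟩ h
    simp only [Finset.mem_sigma, Finset.mem_filter_univ] at h ⊢
    obtain ⟨⟨h₁, h₂⟩, h₃, h₄⟩ := h
    exact ⟨h₃, (strictMono_inv_comp_iff (f := fun i => θ⁻¹ (Fin.natAdd p i)) h₄ _).1 h₁,
      (strictMono_inv_comp_iff (f := fun i => θ⁻¹ (Fin.natAdd p i)) h₄ _).1 h₂⟩
  · rintro ⟨π, θ⟩ h ⟨π', θ'⟩ h' (rfl : θ = θ')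
    simp only [Finset.mem_coe, Finset.mem_sigma, Finset.mem_filter_univ] at h h'
    obtain rfl : π = π' :=
      perm_eq_of_strictMono_comp (f := fun i => θ⁻¹ (Fin.natAdd p i)) h.2.2 h'.2.2
    rfl
  · rintro θ h
    simp only [Finset.mem_coe, Finset.mem_filter_univ] at h
    obtain ⟨π, hπ⟩ := exists_strictMono_comp_perm (f := fun i => θ⁻¹ (Fin.natAdd p i))
      (θ⁻¹.injective.comp (Fin.natAdd_injective _ _))
    refine ⟨⟨π, θ⟩, ?_, rfl⟩
    simp only [Finset.mem_coe, Finset.mem_sigma, Finset.mem_filter_univ]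
    exact ⟨⟨(strictMono_inv_comp_iff hπ _).2 h.2.1, (strictMono_inv_comp_iff hπ _).2 h.2.2⟩, h.1,
      hπ⟩

theorem permCongr_finCongr_inv_apply {m n : ℕ} (h : m = n) (θ : Equiv.Perm (Fin m)) (i : Fin n) :
    ((finCongr h).permCongr θ)⁻¹ i = Fin.cast h (θ⁻¹ (Fin.cast h.symm i)) := by
  subst h
  rfl

theorem mrMul_assoc_single {k : Type*} [CommRing k] (s t u : Σ n : ℕ, Equiv.Perm (Fin n))
    (a b c : k) :
    mrMul k (mrMul k (Finsupp.single s a) (Finsupp.single t b)) (Finsupp.single u c) =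
      mrMul k (Finsupp.single s a) (mrMul k (Finsupp.single t b) (Finsupp.single u c)) := by
  classical
  obtain ⟨p, σ⟩ := s
  obtain ⟨q, τ⟩ := t
  obtain ⟨r, ρ⟩ := u
  rw [mrMul_mrMul_single_left, mrMul_mrMul_single_right, mul_assoc]
  refine sum_single_perm_congr (add_assoc p q r) _ fun θ => ?_
  simp only [permCongr_finCongr_inv_apply]
  refine and_congr Iff.rfl (and_congr Iff.rfl ?_)
  have key : ∀ i, Fin.cast (add_assoc p q r).symm (Fin.natAdd p (Fin.natAdd q (ρ i))) =
      Fin.natAdd (p + q) (ρ i) := fun i => Fin.ext (add_assoc p q _).symm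
  simp only [key]
  exact Iff.rfl

open Classical in
theorem sum_single_strictMono_inv {k : Type*} [CommRing k] {n : ℕ} (σ : Equiv.Perm (Fin n))
    (a : k) :
    ∑ θ : Equiv.Perm (Fin n) with StrictMono (fun i => θ⁻¹ (σ i)),
      (Finsupp.single ⟨n, θ⟩ a : PermAlg k) = Finsupp.single ⟨n, σ⟩ a := by
  have : ∀ θ : Equiv.Perm (Fin n), StrictMono (fun i => θ⁻¹ (σ i)) ↔ θ = σ := by
    refine fun θ => ⟨fun h => ?_, ?_⟩
    · refine perm_eq_of_strictMono_comp (f := fun i => θ⁻¹ i) ?_ h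
      simp [StrictMono]
    · rintro rfl
      simp [StrictMono]
  simp only [this, Finset.filter_eq', Finset.mem_univ, if_true, Finset.sum_singleton]

theorem mrMul_one_left_single {k : Type*} [CommRing k] (s : Σ n : ℕ, Equiv.Perm (Fin n)) (a : k) :
    mrMul k (Finsupp.single ⟨0, 1⟩ 1) (Finsupp.single s a) = Finsupp.single s a := by
  classical
  obtain ⟨n, σ⟩ := s
  rw [mrMul_single, one_mul, ← sum_single_strictMono_inv]
  refine sum_single_perm_congr (zero_add n) _ fun θ => ?_
  simp only [permCongr_finCongr_inv_apply, IsSummand, Subsingleton.strictMono, true_and]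
  have key : ∀ i, Fin.natAdd 0 (σ i) = Fin.cast (zero_add n).symm (σ i) :=
    fun i => Fin.ext (zero_add _)
  simp only [key]
  exact Iff.rfl

theorem mrMul_one_right_single {k : Type*} [CommRing k] (s : Σ n : ℕ, Equiv.Perm (Fin n)) (a : k) :
    mrMul k (Finsupp.single s a) (Finsupp.single ⟨0, 1⟩ 1) = Finsupp.single s a := by
  classical
  obtain ⟨n, σ⟩ := s
  rw [mrMul_single, mul_one, ← sum_single_strictMono_inv]
  refine sum_single_perm_congr (add_zero n) _ fun θ => ?_
  simp only [IsSummand, Subsingleton.strictMono, and_true]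
  exact Iff.rfl

/-- The Malvenuto–Reutenauer product on `⊕_n k[S_n]` is associative, with unit the
empty permutation in `S_0`. -/
theorem stmt10 (k : Type*) [CommRing k] :
    (∀ f g h : PermAlg k, mrMul k (mrMul k f g) h = mrMul k f (mrMul k g h)) ∧
      (∀ f : PermAlg k,
        mrMul k (Finsupp.single (⟨0, 1⟩ : Σ n : ℕ, Equiv.Perm (Fin n)) 1) f = f ∧
          mrMul k f (Finsupp.single (⟨0, 1⟩ : Σ n : ℕ, Equiv.Perm (Fin n)) 1) = f) := by
  refine ⟨fun f g h => ?_, fun f => ⟨?_, ?_⟩⟩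
  · induction f using Finsupp.induction_linear with
    | zero => simp only [mrMul_zero_left]
    | add f f' hf hf' => simp only [mrMul_add_left, hf, hf']
    | single s a =>
      induction g using Finsupp.induction_linear with
      | zero => simp only [mrMul_zero_left, mrMul_zero_right]
      | add g g' hg hg' => simp only [mrMul_add_left, mrMul_add_right, hg, hg']
      | single t b =>
        induction h using Finsupp.induction_linear with
        | zero => simp only [mrMul_zero_right]
        | add h h' hh hh' => simp only [mrMul_add_right, hh, hh']
        | single u c => exact mrMul_assoc_single s t u a b c
  · induction f using Finsupp.induction_linear with
    | zero => exact mrMul_zero_right _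
    | add f f' hf hf' => rw [mrMul_add_right, hf, hf']
    | single s a => exact mrMul_one_left_single s a
  · induction f using Finsupp.induction_linear with
    | zero => exact mrMul_zero_left _
    | add f f' hf hf' => rw [mrMul_add_left, hf, hf']
    | single s a => exact mrMul_one_right_single s a
end

section
/- The deconcatenation-type coproduct Δ̄ on A = ⊕_n k[S_n], defined by Δ̄(σ) = Σ_{i=0}^{n} st(σ(1),…,σ(i)) ⊗ st(σ(i+1),…,σ(n)) for σ ∈ S_n, is coassociative. -/
open TensorProduct

/-- Standardization of a sequence `a : Fin p → ℕ` (inverse of the sorting permutation;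
for `a` injective it is the unique `σ` with `σ i < σ j ↔ a i < a j`). -/
noncomputable def std {p : ℕ} (a : Fin p → ℕ) : Equiv.Perm (Fin p) :=
  (Tuple.sort a)⁻¹

/-- `st(σ(1),…,σ(i))` for `σ ∈ S_n` and `0 ≤ i ≤ n`. -/
noncomputable def frontPerm {n : ℕ} (σ : Equiv.Perm (Fin n)) (i : Fin (n + 1)) :
    Equiv.Perm (Fin (i : ℕ)) :=
  std fun j => (σ (Fin.castLE (Nat.lt_succ_iff.mp i.isLt) j) : ℕ)

/-- `st(σ(i+1),…,σ(n))` for `σ ∈ S_n` and `0 ≤ i ≤ n`. -/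
noncomputable def backPerm {n : ℕ} (σ : Equiv.Perm (Fin n)) (i : Fin (n + 1)) :
    Equiv.Perm (Fin (n - (i : ℕ))) :=
  std fun j => (σ ⟨(i : ℕ) + (j : ℕ), by
    have h1 := j.isLt; have h2 := i.isLt; omega⟩ : ℕ)

/-- The deconcatenation-type coproduct
`Δ̄(σ) = Σ_{i=0}^{n} st(σ(1),…,σ(i)) ⊗ st(σ(i+1),…,σ(n))`, extended linearly. -/
noncomputable def deltaBar (k : Type*) [CommRing k] :
    PermAlg k →ₗ[k] PermAlg k ⊗[k] PermAlg k :=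
  Finsupp.lsum k fun s =>
    LinearMap.toSpanSingleton k _
      (∑ i : Fin (s.1 + 1),
        Finsupp.single (⟨(i : ℕ), frontPerm s.2 i⟩ : Σ n : ℕ, Equiv.Perm (Fin n)) (1 : k)
          ⊗ₜ[k]
        Finsupp.single (⟨s.1 - (i : ℕ), backPerm s.2 i⟩ : Σ n : ℕ, Equiv.Perm (Fin n)) (1 : k))

theorem std_congr {p : ℕ} {a b : Fin p → ℕ} (h : ∀ i j, a i < a j ↔ b i < b j) :
    std a = std b := by
  have key : Tuple.sort b = Tuple.sort a := by
    rw [Tuple.eq_sort_iff]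
    obtain ⟨hmono, hlt⟩ := Tuple.eq_sort_iff.mp (rfl : Tuple.sort b = Tuple.sort b)
    refine ⟨fun i j hij => not_lt.mp fun hc => ?_, fun i j hij he => hlt i j hij ?_⟩
    · exact absurd (hmono hij) (not_le.mpr ((h _ _).mp hc))
    · have h₁ := h (Tuple.sort b i) (Tuple.sort b j)
      have h₂ := h (Tuple.sort b j) (Tuple.sort b i)
      omega
  rw [std, std, key]

theorem std_lt_std_iff {p : ℕ} {a : Fin p → ℕ} (ha : Function.Injective a) (i j : Fin p) :
    std a i < std a j ↔ a i < a j := by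
  have hs : StrictMono (a ∘ Tuple.sort a) :=
    (Tuple.monotone_sort a).strictMono_of_injective (ha.comp (Tuple.sort a).injective)
  have h := hs.lt_iff_lt (a := std a i) (b := std a j)
  simpa [std] using h.symm

theorem std_coe_perm {n : ℕ} (σ : Equiv.Perm (Fin n)) : std (fun j => (σ j : ℕ)) = σ := by
  have key : σ⁻¹ = Tuple.sort fun j => (σ j : ℕ) := by
    rw [Tuple.eq_sort_iff]
    refine ⟨fun i j hij => ?_, fun i j hij he => ?_⟩
    · simpa using hij
    · simp only [← Equiv.Perm.mul_apply, mul_inv_cancel, Equiv.Perm.one_apply] at he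
      exact absurd he (Nat.ne_of_lt hij)
  rw [std, ← key, inv_inv]

/-- The standardization of the factor of length `p` of the infinite word `w` starting at
position `a`. -/
noncomputable def stdFactor (w : ℕ → ℕ) (a p : ℕ) : Σ n : ℕ, Equiv.Perm (Fin n) :=
  ⟨p, std fun j : Fin p => w (a + j)⟩

theorem exists_stdFactor_eq (s : Σ n : ℕ, Equiv.Perm (Fin n)) :
    ∃ w : ℕ → ℕ, Function.Injective w ∧ stdFactor w 0 s.1 = s := by
  obtain ⟨n, σ⟩ := s
  refine ⟨fun m => if h : m < n then σ ⟨m, h⟩ else m, fun x y hxy => ?_, ?_⟩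
  · dsimp only at hxy
    split_ifs at hxy with hx hy hy
    · simpa using σ.injective (Fin.ext hxy)
    · have := (σ ⟨x, hx⟩).isLt
      omega
    · have := (σ ⟨y, hy⟩).isLt
      omega
    · exact hxy
  · simp [stdFactor, std_coe_perm]

theorem injective_factor {w : ℕ → ℕ} (hw : Function.Injective w) (a p : ℕ) :
    Function.Injective fun j : Fin p => w (a + j) :=
  fun _ _ h => Fin.ext (Nat.add_left_cancel (hw h))

theorem frontPerm_stdFactor {w : ℕ → ℕ} (hw : Function.Injective w) (a n : ℕ)
    (i : Fin (n + 1)) :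
    (⟨(i : ℕ), frontPerm (stdFactor w a n).2 i⟩ : Σ n : ℕ, Equiv.Perm (Fin n)) =
      stdFactor w a i := by
  refine congrArg (Sigma.mk (i : ℕ)) (std_congr fun x y => ?_)
  exact std_lt_std_iff (injective_factor hw a n) _ _

theorem backPerm_stdFactor {w : ℕ → ℕ} (hw : Function.Injective w) (a n : ℕ)
    (i : Fin (n + 1)) :
    (⟨n - (i : ℕ), backPerm (stdFactor w a n).2 i⟩ : Σ n : ℕ, Equiv.Perm (Fin n)) =
      stdFactor w (a + i) (n - i) := by
  refine congrArg (Sigma.mk (n - (i : ℕ))) (std_congr fun x y => ?_)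
  simp only [Nat.add_assoc]
  exact std_lt_std_iff (injective_factor hw a n) _ _

theorem deltaBar_stdFactor (k : Type*) [CommRing k] {w : ℕ → ℕ} (hw : Function.Injective w)
    (a n : ℕ) :
    deltaBar k (Finsupp.single (stdFactor w a n) 1) =
      ∑ p ∈ Finset.HasAntidiagonal.antidiagonal n,
        (Finsupp.single (stdFactor w a p.1) (1 : k) : PermAlg k) ⊗ₜ[k]
          (Finsupp.single (stdFactor w (a + p.1) p.2) (1 : k) : PermAlg k) := by
  rw [Finset.Nat.sum_antidiagonal_eq_sum_range_succ_mk, ← Fin.sum_univ_eq_sum_range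
    (fun i => (Finsupp.single (stdFactor w a i) (1 : k) : PermAlg k) ⊗ₜ[k]
      (Finsupp.single (stdFactor w (a + i) (n - i)) (1 : k) : PermAlg k))]
  simp only [← frontPerm_stdFactor hw, ← backPerm_stdFactor hw]
  simp only [deltaBar, Finsupp.lsum_single, LinearMap.toSpanSingleton_apply, one_smul]
  rfl

/-- The deconcatenation coproduct `Δ̄` on `⊕_n k[S_n]` is coassociative. -/
theorem stmt11 (k : Type*) [CommRing k] :
    ∀ x : PermAlg k,
      TensorProduct.assoc k (PermAlg k) (PermAlg k) (PermAlg k)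
          (TensorProduct.map (deltaBar k) LinearMap.id (deltaBar k x)) =
        TensorProduct.map LinearMap.id (deltaBar k) (deltaBar k x) := by
  suffices h : (TensorProduct.assoc k (PermAlg k) (PermAlg k) (PermAlg k)).toLinearMap ∘ₗ
      TensorProduct.map (deltaBar k) LinearMap.id ∘ₗ deltaBar k =
        TensorProduct.map LinearMap.id (deltaBar k) ∘ₗ deltaBar k from
    fun x => LinearMap.congr_fun h x
  refine Finsupp.lhom_ext' fun s => LinearMap.ext_ring ?_
  obtain ⟨w, hw, hs⟩ := exists_stdFactor_eq s
  rw [← hs]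
  simp only [LinearMap.comp_apply, Finsupp.lsingle_apply, LinearEquiv.coe_coe,
    deltaBar_stdFactor k hw, map_sum, TensorProduct.map_tmul, LinearMap.id_apply,
    TensorProduct.sum_tmul, TensorProduct.tmul_sum, TensorProduct.assoc_tmul]
  rw [Finset.sum_sigma', Finset.sum_sigma']
  refine Finset.sum_nbij' (fun x => ⟨(x.2.1, x.2.2 + x.1.2), (x.2.2, x.1.2)⟩)
    (fun x => ⟨(x.1.1 + x.2.1, x.2.2), (x.1.1, x.2.1)⟩) ?_ ?_ ?_ ?_ ?_
  all_goals
    rintro ⟨⟨b, c⟩, ⟨d, e⟩⟩ h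
    simp only [Finset.mem_sigma, Finset.HasAntidiagonal.mem_antidiagonal] at h ⊢
    obtain ⟨h₁, h₂⟩ := h
    subst h₂
  · exact ⟨by omega, trivial⟩
  · exact ⟨by omega, trivial⟩
  · rfl
  · rfl
  · rw [Nat.add_assoc]
end
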